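/- arXiv:2011.09465 — 4 statements merged into one kernel-verified Lean document; each statement's English description precedes it below -/
import Mathlib

section
/- Fix a model M ∈ ℳ and let δ_Z ∈ (0, 1). Suppose the latent window z = (z₁, …, z_{2h}) is drawn i.i.d. from f(z; θ₂*, M) for some θ₂* ∈ Θ₂(M), and define the level-2 change statistic Φ^Z = (1/(2h)) [ L_NML(z; M) − L_NML(z⁻; M) − L_NML(z⁺; M) ], where z⁻ and z⁺ are the first and second halves of the window. If the threshold satisfies ε_Z ≥ (log C_Z(M) − log δ_Z) / (2h), where C_Z(M) is the parametric complexity of the latent family over windows of length 2h, then P(Φ^Z > ε_Z) ≤ δ_Z. -/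
noncomputable section

/-- First half (length `h`) of a window of length `2*h`. -/
def firstHalf {γ : Type*} (h : ℕ) (w : Fin (2 * h) → γ) : Fin h → γ :=
  fun i => w ⟨i.1, by have := i.2; omega⟩

/-- Second half (length `h`) of a window of length `2*h`. -/
def secondHalf {γ : Type*} (h : ℕ) (w : Fin (2 * h) → γ) : Fin h → γ :=
  fun i => w ⟨h + i.1, by have := i.2; omega⟩

/-- Parametric complexity of the latent family over sequences of length `n`,
`C_Z^{(n)} = ∑_{zⁿ} f(zⁿ; θ̂₂)`, where `fhat₂ n z` is the maximized likelihood. -/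
def CZ {𝒵 : Type*} [Fintype 𝒵] (fhat₂ : (n : ℕ) → (Fin n → 𝒵) → ℝ) (n : ℕ) : ℝ :=
  ∑ z : Fin n → 𝒵, fhat₂ n z

/-- NML code length `L_NML(zⁿ) = -log₂ f(zⁿ; θ̂₂) + log₂ C_Z^{(n)}`. -/
def LNMLz {𝒵 : Type*} [Fintype 𝒵] (fhat₂ : (n : ℕ) → (Fin n → 𝒵) → ℝ)
    (n : ℕ) (z : Fin n → 𝒵) : ℝ :=
  -Real.logb 2 (fhat₂ n z) + Real.logb 2 (CZ fhat₂ n)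

/-- Level-2 change statistic
`Φ^Z = (1/(2h)) [ L_NML(z) − L_NML(z⁻) − L_NML(z⁺) ]` on a window of length `2h`. -/
def PhiZ {𝒵 : Type*} [Fintype 𝒵] (fhat₂ : (n : ℕ) → (Fin n → 𝒵) → ℝ)
    (h : ℕ) (w : Fin (2 * h) → 𝒵) : ℝ :=
  (1 / (2 * (h : ℝ))) *
    (LNMLz fhat₂ (2 * h) w - LNMLz fhat₂ h (firstHalf h w) - LNMLz fhat₂ h (secondHalf h w))

theorem injective_firstHalf_secondHalf {γ : Type*} (h : ℕ) :
    Function.Injective fun w : Fin (2 * h) → γ => (firstHalf h w, secondHalf h w) := by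
  intro w w' hw
  obtain ⟨h1, h2⟩ := Prod.mk.inj hw
  funext i
  by_cases hi : i.1 < h
  · exact congrFun h1 ⟨i.1, hi⟩
  · have hk : i.1 - h < h := by have := i.2; omega
    have hw2 := congrFun h2 ⟨i.1 - h, hk⟩
    have hidx : (⟨h + (i.1 - h), by omega⟩ : Fin (2 * h)) = i := by ext; simp; omega
    simpa only [secondHalf, hidx] using hw2

/-- The product of two nonnegative functions of the halves sums to at most the product of the
sums. -/
theorem sum_firstHalf_mul_secondHalf_le {γ : Type*} [Fintype γ] (h : ℕ) (g : (Fin h → γ) → ℝ)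
    (hg : ∀ z, 0 ≤ g z) :
    ∑ w : Fin (2 * h) → γ, g (firstHalf h w) * g (secondHalf h w) ≤ (∑ z, g z) * ∑ z, g z := by
  classical
  rw [Fintype.sum_mul_sum, ← Fintype.sum_prod_type' (f := fun x y => g x * g y)]
  rw [← Finset.sum_image (f := fun p : (Fin h → γ) × (Fin h → γ) => g p.1 * g p.2)
    (injective_firstHalf_secondHalf h).injOn]
  exact Finset.sum_le_sum_of_subset_of_nonneg (Finset.subset_univ _)
    fun p _ _ => mul_nonneg (hg _) (hg _)

/-- On a window whose maximized likelihoods are positive, exceeding the threshold bounds the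
maximized likelihood by `δ` times the product of the NML probabilities of the halves. -/
theorem le_mul_of_lt_PhiZ {𝒵 : Type*} [Fintype 𝒵] {fhat₂ : (n : ℕ) → (Fin n → 𝒵) → ℝ}
    {h : ℕ} (hpos : 0 < h) {δ ε : ℝ} (hδ : 0 < δ)
    (hε : (Real.logb 2 (CZ fhat₂ (2 * h)) - Real.logb 2 δ) / (2 * h) ≤ ε)
    {w : Fin (2 * h) → 𝒵} (hw : 0 < fhat₂ (2 * h) w)
    (hw1 : 0 < fhat₂ h (firstHalf h w)) (hw2 : 0 < fhat₂ h (secondHalf h w))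
    (hC : 0 < CZ fhat₂ h) (hΦ : ε < PhiZ fhat₂ h w) :
    fhat₂ (2 * h) w ≤ δ * (fhat₂ h (firstHalf h w) / CZ fhat₂ h *
      (fhat₂ h (secondHalf h w) / CZ fhat₂ h)) := by
  have hh : (0 : ℝ) < 2 * h := by positivity
  have key := hε.trans_lt hΦ
  rw [PhiZ, one_div_mul_eq_div, div_lt_div_iff_of_pos_right hh] at key
  simp only [LNMLz] at key
  have h1 : 0 < fhat₂ h (firstHalf h w) / CZ fhat₂ h := div_pos hw1 hC
  have h2 : 0 < fhat₂ h (secondHalf h w) / CZ fhat₂ h := div_pos hw2 hC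
  rw [← Real.logb_le_logb one_lt_two hw (by positivity),
    Real.logb_mul hδ.ne' (mul_pos h1 h2).ne', Real.logb_mul h1.ne' h2.ne',
    Real.logb_div hw1.ne' hC.ne', Real.logb_div hw2.ne' hC.ne']
  linarith

/-- **Reliable alarms at level 2.**  If the latent window `z = (z₁, …, z_{2h})`
is i.i.d. from `f(z; θ₂*, M)` and the threshold satisfies
`ε_Z ≥ (log₂ C_Z(M) − log₂ δ_Z) / (2h)`, then `P(Φ^Z > ε_Z) ≤ δ_Z`. -/
theorem level2_type_one_error
    {𝒵 : Type*} [Fintype 𝒵] [Nonempty 𝒵]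
    (h : ℕ) (hpos : 0 < h)
    (Θ₂ : Type*) [Nonempty Θ₂]
    (f₂ : Θ₂ → 𝒵 → ℝ)
    (hf₂0 : ∀ θ z, 0 ≤ f₂ θ z) (hf₂1 : ∀ θ, ∑ z, f₂ θ z = 1)
    (fhat₂ : (n : ℕ) → (Fin n → 𝒵) → ℝ)
    (hfhat₂ : ∀ n (z : Fin n → 𝒵),
      IsGreatest (Set.range fun θ : Θ₂ => ∏ i, f₂ θ (z i)) (fhat₂ n z))
    (θstar : Θ₂)
    (δZ : ℝ) (hδZ : δZ ∈ Set.Ioo (0 : ℝ) 1)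
    (εZ : ℝ)
    (hεZ : εZ ≥ (Real.logb 2 (CZ fhat₂ (2 * h)) - Real.logb 2 δZ) / (2 * h)) :
    ∑ w : Fin (2 * h) → 𝒵,
      Set.indicator {w : Fin (2 * h) → 𝒵 | PhiZ fhat₂ h w > εZ}
        (fun w => ∏ i, f₂ θstar (w i)) w
      ≤ δZ := by
  have hfhat_nonneg : ∀ n (z : Fin n → 𝒵), 0 ≤ fhat₂ n z := fun n z =>
    (Finset.prod_nonneg fun i _ => hf₂0 θstar (z i)).trans ((hfhat₂ n z).2 ⟨θstar, rfl⟩)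
  have hfhat_pos : ∀ n (z : Fin n → 𝒵), (∀ i, 0 < f₂ θstar (z i)) → 0 < fhat₂ n z :=
    fun n z hz => (Finset.prod_pos fun i _ => hz i).trans_le ((hfhat₂ n z).2 ⟨θstar, rfl⟩)
  have hC : 0 ≤ CZ fhat₂ h := Finset.sum_nonneg fun z _ => hfhat_nonneg h z
  set g : (Fin h → 𝒵) → ℝ := fun z => fhat₂ h z / CZ fhat₂ h with hg
  have hg0 : ∀ z, 0 ≤ g z := fun z => div_nonneg (hfhat_nonneg h z) hC
  have hgsum : ∑ z, g z ≤ 1 := by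
    rw [hg, ← Finset.sum_div]
    exact div_self_le_one (CZ fhat₂ h)
  have hpt : ∀ w : Fin (2 * h) → 𝒵,
      Set.indicator {w : Fin (2 * h) → 𝒵 | PhiZ fhat₂ h w > εZ}
        (fun w => ∏ i, f₂ θstar (w i)) w ≤ δZ * (g (firstHalf h w) * g (secondHalf h w)) := by
    have hr : ∀ w : Fin (2 * h) → 𝒵, 0 ≤ δZ * (g (firstHalf h w) * g (secondHalf h w)) :=
      fun w => mul_nonneg hδZ.1.le (mul_nonneg (hg0 _) (hg0 _))
    refine Set.indicator_le' (f := fun w => ∏ i, f₂ θstar (w i))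
      (g := fun w => δZ * (g (firstHalf h w) * g (secondHalf h w))) ?_ fun w _ => hr w
    · intro w hΦ
      by_cases hw : ∀ i, 0 < f₂ θstar (w i)
      · have hw1 := hfhat_pos h (firstHalf h w) fun i => hw _
        have hw2 := hfhat_pos h (secondHalf h w) fun i => hw _
        have hCpos : 0 < CZ fhat₂ h :=
          hw1.trans_le (Finset.single_le_sum (f := fhat₂ h) (fun z _ => hfhat_nonneg h z)
            (Finset.mem_univ _))
        exact ((hfhat₂ (2 * h) w).2 ⟨θstar, rfl⟩).trans
          (le_mul_of_lt_PhiZ hpos hδZ.1 hεZ (hfhat_pos _ w hw) hw1 hw2 hCpos hΦ)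
      · push Not at hw
        obtain ⟨i, hi⟩ := hw
        have hzero : ∏ i, f₂ θstar (w i) = 0 :=
          Finset.prod_eq_zero (Finset.mem_univ i) (le_antisymm hi (hf₂0 _ _))
        simp only [hzero]
        exact hr w
  calc _ ≤ ∑ w : Fin (2 * h) → 𝒵, δZ * (g (firstHalf h w) * g (secondHalf h w)) :=
        Finset.sum_le_sum fun w _ => hpt w
    _ = δZ * ∑ w : Fin (2 * h) → 𝒵, g (firstHalf h w) * g (secondHalf h w) :=
        (Finset.mul_sum _ _ _).symm
    _ ≤ δZ * 1 := by
        refine mul_le_mul_of_nonneg_left ?_ hδZ.1.le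
        exact (sum_firstHalf_mul_secondHalf_le h g hg0).trans
          (mul_le_one₀ hgsum (Finset.sum_nonneg fun z _ => hg0 z) hgsum)
    _ = δZ := mul_one _

end
end

section
/- For every m ∈ ℝ, the p-probability that the code length beats the ideal code length of p by at least m bits is at most 2^{−m}: p({ x ∈ α : L(x) ≤ −log₂ p(x) − m }) ≤ 2^{−m}. -/
/-- A code length that beats the ideal code length `-log₂ q` by `m` bits bounds `q`. -/
theorem le_two_rpow_mul_of_le_neg_logb_sub {q l m : ℝ} (hq : 0 ≤ q)
    (h : l ≤ -Real.logb 2 q - m) : q ≤ (2 : ℝ) ^ (-m) * (2 : ℝ) ^ (-l) := by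
  rcases hq.eq_or_lt with rfl | hq
  · positivity
  · rw [← Real.rpow_add two_pos, ← Real.logb_le_iff_le_rpow one_lt_two hq]
    linarith

/-- **No-hypercompression inequality.**
Let `α` be a countable type, `p` a probability mass function on `α`, and
`L : α → ℝ` a code-length function satisfying Kraft's inequality
`∑' x, 2^(-L x) ≤ 1`.  Then for every `m : ℝ`, the `p`-probability that the
code length beats the ideal code length `-log₂ (p x)` by at least `m` bits is
at most `2^(-m)`. -/
theorem no_hypercompression
    {α : Type*} [Countable α]
    (p : α → ℝ) (hp0 : ∀ x, 0 ≤ p x) (hpsum : Summable p)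
    (hp1 : ∑' x, p x = 1)
    (L : α → ℝ) (hLsum : Summable fun x => (2 : ℝ) ^ (-L x))
    (hKraft : ∑' x, (2 : ℝ) ^ (-L x) ≤ 1)
    (m : ℝ) :
    ∑' x, Set.indicator {x : α | L x ≤ -Real.logb 2 (p x) - m} p x
      ≤ (2 : ℝ) ^ (-m) := by
  have hle : ∀ x, Set.indicator {x : α | L x ≤ -Real.logb 2 (p x) - m} p x
      ≤ (2 : ℝ) ^ (-m) * (2 : ℝ) ^ (-L x) := fun x =>
    Set.indicator_apply_le' (fun hx => le_two_rpow_mul_of_le_neg_logb_sub (hp0 x) hx)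
      fun _ => by positivity
  calc ∑' x, Set.indicator {x : α | L x ≤ -Real.logb 2 (p x) - m} p x
      ≤ ∑' x, (2 : ℝ) ^ (-m) * (2 : ℝ) ^ (-L x) :=
        (hpsum.indicator _).tsum_le_tsum hle (hLsum.mul_left _)
    _ = (2 : ℝ) ^ (-m) * ∑' x, (2 : ℝ) ^ (-L x) := tsum_mul_left
    _ ≤ (2 : ℝ) ^ (-m) := mul_le_of_le_one_right (by positivity) hKraft
end

section
/- The combined code length x ↦ min_{i ∈ I} ( L_i(x) + c(i) ) again satisfies Kraft's inequality: Σ_{x ∈ α} 2^{−min_{i ∈ I} ( L_i(x) + c(i) )} ≤ 1. -/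
/-- The weight `2 ^ (-min_i (L i + c i))` is at most the mixture of the weights `2 ^ (-L i)`. -/
theorem two_rpow_neg_iInf_add_le_sum {I : Type*} [Fintype I] [Nonempty I] (l c : I → ℝ) :
    (2 : ℝ) ^ (-(⨅ i, (l i + c i))) ≤ ∑ i, (2 : ℝ) ^ (-(c i)) * (2 : ℝ) ^ (-(l i)) := by
  obtain ⟨i, hi⟩ := exists_eq_ciInf_of_finite (f := fun i => l i + c i)
  rw [← hi, neg_add_rev, Real.rpow_add two_pos]
  exact Finset.single_le_sum (f := fun i => (2 : ℝ) ^ (-(c i)) * (2 : ℝ) ^ (-(l i)))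
    (fun _ _ => by positivity) (Finset.mem_univ i)

/-- **Kraft's inequality for a two-part (mixture-of-minima) code.**
Let `α` be a countable type and `I` a nonempty finite index set.  For each
`i : I` let `L i : α → ℝ` satisfy Kraft's inequality `∑' x, 2^(-(L i x)) ≤ 1`,
and let `c : I → ℝ` satisfy `∑ i, 2^(-(c i)) ≤ 1`.  Then the combined code
length `x ↦ min_i (L i x + c i)` again satisfies Kraft's inequality. -/
theorem kraft_min_combined
    {α : Type*} [Countable α] {I : Type*} [Fintype I] [Nonempty I]
    (L : I → α → ℝ)
    (hLsum : ∀ i, Summable fun x => (2 : ℝ) ^ (-(L i x)))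
    (hKraft : ∀ i, ∑' x, (2 : ℝ) ^ (-(L i x)) ≤ 1)
    (c : I → ℝ) (hc : ∑ i, (2 : ℝ) ^ (-(c i)) ≤ 1) :
    ∑' x, (2 : ℝ) ^ (-(⨅ i, (L i x + c i))) ≤ 1 := by
  have hmul : ∀ i ∈ Finset.univ, Summable fun x => (2 : ℝ) ^ (-(c i)) * (2 : ℝ) ^ (-(L i x)) :=
    fun i _ => (hLsum i).mul_left _
  have hle : ∀ x, (2 : ℝ) ^ (-(⨅ i, (L i x + c i))) ≤
      ∑ i, (2 : ℝ) ^ (-(c i)) * (2 : ℝ) ^ (-(L i x)) :=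
    fun x => two_rpow_neg_iInf_add_le_sum (fun i => L i x) c
  have hsum := summable_sum hmul
  calc ∑' x, (2 : ℝ) ^ (-(⨅ i, (L i x + c i)))
      ≤ ∑' x, ∑ i, (2 : ℝ) ^ (-(c i)) * (2 : ℝ) ^ (-(L i x)) :=
        (Summable.of_nonneg_of_le (fun _ => by positivity) hle hsum).tsum_le_tsum hle hsum
    _ = ∑ i, (2 : ℝ) ^ (-(c i)) * ∑' x, (2 : ℝ) ^ (-(L i x)) := by
        rw [Summable.tsum_finsetSum hmul]
        simp only [tsum_mul_left]
    _ ≤ ∑ i, (2 : ℝ) ^ (-(c i)) :=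
        Finset.sum_le_sum fun i _ => mul_le_of_le_one_right (by positivity) (hKraft i)
    _ ≤ 1 := hc
end

section
/- For every a ∈ ℝ, q({ x ∈ α : p(x) ≥ 2^{−a} · q(x) }) ≤ 2^{a/2} · Σ_{x ∈ α} ( p(x) · q(x) )^{1/2}. In particular, the probability under q of the event that the sub-probability mass p exceeds q by at most a factor 2^{a} is controlled by the Bhattacharyya affinity Σ_x √(p(x) q(x)). -/
theorem summable_sqrt_mul {α : Type*} {p q : α → ℝ} (hp0 : ∀ x, 0 ≤ p x) (hq0 : ∀ x, 0 ≤ q x)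
    (hp : Summable p) (hq : Summable q) : Summable fun x => Real.sqrt (p x * q x) := by
  refine Summable.of_nonneg_of_le (fun x => Real.sqrt_nonneg _) (fun x => ?_) (hp.add hq)
  rw [Real.sqrt_le_left (add_nonneg (hp0 x) (hq0 x))]
  nlinarith [mul_nonneg (hp0 x) (hq0 x), sq_nonneg (p x), sq_nonneg (q x)]

theorem le_rpow_mul_sqrt_mul {a s t : ℝ} (ht : 0 ≤ t) (h : (2 : ℝ) ^ (-a) * t ≤ s) :
    t ≤ (2 : ℝ) ^ (a / 2) * Real.sqrt (s * t) := by
  have h_sq : ((2 : ℝ) ^ (-(a / 2)) * t) ^ 2 ≤ s * t := by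
    have h_pow : ((2 : ℝ) ^ (-(a / 2))) ^ 2 = (2 : ℝ) ^ (-a) := by
      rw [sq, ← Real.rpow_add two_pos]
      congr 1
      ring
    calc ((2 : ℝ) ^ (-(a / 2)) * t) ^ 2 = (2 : ℝ) ^ (-a) * t * t := by rw [mul_pow, h_pow]; ring
      _ ≤ s * t := mul_le_mul_of_nonneg_right h ht
  calc t = (2 : ℝ) ^ (a / 2) * ((2 : ℝ) ^ (-(a / 2)) * t) := by
        rw [← mul_assoc, ← Real.rpow_add two_pos, add_neg_cancel, Real.rpow_zero, one_mul]
    _ ≤ (2 : ℝ) ^ (a / 2) * Real.sqrt (s * t) :=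
        mul_le_mul_of_nonneg_left (Real.le_sqrt_of_sq_le h_sq) (by positivity)

/-- **Bhattacharyya-type bound.**
Let `α` be a countable type, `q` a probability mass function on `α` and
`p : α → [0,∞)` a sub-probability mass function (`∑' x, p x ≤ 1`).  Then for
every `a : ℝ`, the `q`-probability of the event `{x | p x ≥ 2^(-a) * q x}` is
at most `2^(a/2)` times the Bhattacharyya affinity `∑' x, √(p x * q x)`. -/
theorem bhattacharyya_event_bound
    {α : Type*} [Countable α]
    (q : α → ℝ) (hq0 : ∀ x, 0 ≤ q x) (hqsum : Summable q)
    (hq1 : ∑' x, q x = 1)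
    (p : α → ℝ) (hp0 : ∀ x, 0 ≤ p x) (hpsum : Summable p)
    (hp1 : ∑' x, p x ≤ 1)
    (a : ℝ) :
    ∑' x, Set.indicator {x : α | p x ≥ (2 : ℝ) ^ (-a) * q x} q x
      ≤ (2 : ℝ) ^ (a / 2) * ∑' x, Real.sqrt (p x * q x) := by
  rw [← tsum_mul_left]
  refine (hqsum.indicator _).tsum_le_tsum (fun x => ?_)
    ((summable_sqrt_mul hp0 hq0 hpsum hqsum).mul_left _)
  exact Set.indicator_apply_le' (fun hx => le_rpow_mul_sqrt_mul (hq0 x) hx)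
    fun _ => by positivity
end
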